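/- arXiv:1909.03468 — 6 statements merged into one kernel-verified Lean document; each statement's English description precedes it below -/
import Mathlib

section
/- Let g ≥ 2. In the presented group G_g = ⟨c_1, …, c_{2g} ∣ c_1c_2⋯c_{2g} = c_{2g}⋯c_2c_1⟩, for every j with 2 ≤ j ≤ 2g and every integer s ≥ 1 the following two identities hold: c_j·(c_{j−1}c_{j−2}⋯c_1·c_{2g}⁻¹c_{2g−1}⁻¹⋯c_{j+1}⁻¹)^s·c_j⁻¹ = (c_{j+1}⁻¹c_{j+2}⁻¹⋯c_{2g}⁻¹·c_1c_2⋯c_{j−1})^s, and c_j·(c_{j+1}c_{j+2}⋯c_{2g}·c_1⁻¹c_2⁻¹⋯c_{j−1}⁻¹)^s·c_j⁻¹ = (c_{j−1}⁻¹c_{j−2}⁻¹⋯c_1⁻¹·c_{2g}c_{2g−1}⋯c_{j+1})^s. -/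
/-- The relator `c_1 c_2 ⋯ c_{2g} (c_{2g} ⋯ c_2 c_1)⁻¹` in the free group on `Fin (2*g)`
(the generator `c_k`, `1 ≤ k ≤ 2g`, corresponds to the index `k - 1`). -/
def surfaceRel (g : ℕ) : FreeGroup (Fin (2 * g)) :=
  (List.ofFn fun i : Fin (2 * g) => FreeGroup.of i).prod *
    ((List.ofFn fun i : Fin (2 * g) => FreeGroup.of i).reverse.prod)⁻¹

/-- The presented group `G_g = ⟨c_1, …, c_{2g} ∣ c_1 c_2 ⋯ c_{2g} = c_{2g} ⋯ c_2 c_1⟩`. -/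
abbrev SurfaceGroup (g : ℕ) : Type := PresentedGroup {surfaceRel g}

/-- The generator `c_k` of `G_g`, with the 1-based index `k` (for `1 ≤ k ≤ 2g`). -/
def cgen (g : ℕ) (k : ℕ) : SurfaceGroup g :=
  if h : k - 1 < 2 * g then PresentedGroup.of (⟨k - 1, h⟩ : Fin (2 * g)) else 1

/-- The ascending product `c_a c_{a+1} ⋯ c_b` in `G_g`. -/
def cUp (g a b : ℕ) : SurfaceGroup g :=
  ((List.range' a (b + 1 - a)).map (cgen g)).prod

/-- The descending product `c_b c_{b-1} ⋯ c_a` in `G_g`. -/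
def cDown (g a b : ℕ) : SurfaceGroup g :=
  ((List.range' a (b + 1 - a)).reverse.map (cgen g)).prod

/-- The ascending product of inverses `c_a⁻¹ c_{a+1}⁻¹ ⋯ c_b⁻¹` in `G_g`. -/
def cUpInv (g a b : ℕ) : SurfaceGroup g :=
  ((List.range' a (b + 1 - a)).map fun k => (cgen g k)⁻¹).prod

/-- The descending product of inverses `c_b⁻¹ c_{b-1}⁻¹ ⋯ c_a⁻¹` in `G_g`. -/
def cDownInv (g a b : ℕ) : SurfaceGroup g :=
  ((List.range' a (b + 1 - a)).reverse.map fun k => (cgen g k)⁻¹).prod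

theorem cUpInv_eq_inv_cDown (g a b : ℕ) : cUpInv g a b = (cDown g a b)⁻¹ := by
  simp [cUpInv, cDown, List.prod_inv_reverse, Function.comp_def]

theorem cDownInv_eq_inv_cUp (g a b : ℕ) : cDownInv g a b = (cUp g a b)⁻¹ := by
  simp [cDownInv, cUp, List.prod_inv_reverse, Function.comp_def]

theorem range'_one_split {j n : ℕ} (hj : 1 ≤ j) (hjn : j ≤ n) :
    List.range' 1 n = List.range' 1 (j - 1) ++ j :: List.range' (j + 1) (n - j) := by
  rw [← List.range'_succ, show n = (j - 1) + (n - j + 1) by omega, ← List.range'_append]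
  congr 2 <;> omega

theorem cUp_split (g : ℕ) {j n : ℕ} (hj : 1 ≤ j) (hjn : j ≤ n) :
    cUp g 1 n = cUp g 1 (j - 1) * (cgen g j * cUp g (j + 1) n) := by
  simp [cUp, range'_one_split hj hjn]

theorem cDown_split (g : ℕ) {j n : ℕ} (hj : 1 ≤ j) (hjn : j ≤ n) :
    cDown g 1 n = cDown g (j + 1) n * cgen g j * cDown g 1 (j - 1) := by
  simp [cDown, range'_one_split hj hjn, mul_assoc]

theorem map_cgen_range' (g : ℕ) :
    (List.range' 1 (2 * g)).map (cgen g) =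
      (List.ofFn fun i : Fin (2 * g) => FreeGroup.of i).map (PresentedGroup.mk {surfaceRel g}) := by
  refine List.ext_getElem (by simp) fun i h₁ h₂ => ?_
  have hi : i < 2 * g := by simpa using h₁
  simp [cgen, hi, PresentedGroup.of]

theorem cUp_eq_cDown (g : ℕ) : cUp g 1 (2 * g) = cDown g 1 (2 * g) := by
  have h : PresentedGroup.mk {surfaceRel g} (surfaceRel g) = 1 :=
    PresentedGroup.one_of_mem (Set.mem_singleton _)
  rw [surfaceRel, map_mul, map_inv, mul_inv_eq_one, map_list_prod, map_list_prod,
    List.map_reverse] at h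
  rw [cUp, cDown, Nat.add_sub_cancel, List.map_reverse, map_cgen_range']
  exact h

/-- In `G_g = ⟨c_1, …, c_{2g} ∣ c_1⋯c_{2g} = c_{2g}⋯c_1⟩` (`g ≥ 2`), for `2 ≤ j ≤ 2g` and
`s ≥ 1` one has
`c_j (c_{j−1}⋯c_1 c_{2g}⁻¹⋯c_{j+1}⁻¹)^s c_j⁻¹ = (c_{j+1}⁻¹⋯c_{2g}⁻¹ c_1⋯c_{j−1})^s` and
`c_j (c_{j+1}⋯c_{2g} c_1⁻¹⋯c_{j−1}⁻¹)^s c_j⁻¹ = (c_{j−1}⁻¹⋯c_1⁻¹ c_{2g}⋯c_{j+1})^s`. -/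
theorem statement_1 (g : ℕ) (hg : 2 ≤ g) (j s : ℕ) (hj1 : 2 ≤ j) (hj2 : j ≤ 2 * g)
    (hs : 1 ≤ s) :
    cgen g j * (cDown g 1 (j - 1) * cDownInv g (j + 1) (2 * g)) ^ s * (cgen g j)⁻¹ =
      (cUpInv g (j + 1) (2 * g) * cUp g 1 (j - 1)) ^ s ∧
    cgen g j * (cUp g (j + 1) (2 * g) * cUpInv g 1 (j - 1)) ^ s * (cgen g j)⁻¹ =
      (cDownInv g 1 (j - 1) * cDown g (j + 1) (2 * g)) ^ s := by
  have h := cUp_eq_cDown g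
  rw [cUp_split g (by omega) hj2, cDown_split g (by omega) hj2] at h
  simp only [cUpInv_eq_inv_cDown, cDownInv_eq_inv_cUp, ← conj_pow]
  constructor <;> congr 1 <;>
    rw [eq_inv_mul_iff_mul_eq, ← mul_assoc, mul_inv_eq_iff_eq_mul, ← mul_assoc, ← mul_assoc,
      mul_inv_eq_iff_eq_mul, mul_assoc (cUp g 1 (j - 1)), h]
end

section
/- Let g ≥ 2 and let K be a field. In the free associative algebra A = K⟨x_1, y_1, …, x_{2g}, y_{2g}⟩, for every j with 2 ≤ j ≤ 2g and every integer s ≥ 1, the polynomials x_j·(x_{j−1}x_{j−2}⋯x_1·y_{2g}y_{2g−1}⋯y_{j+1})^s·y_j − (y_{j+1}y_{j+2}⋯y_{2g}·x_1x_2⋯x_{j−1})^s and x_j·(x_{j+1}x_{j+2}⋯x_{2g}·y_1y_2⋯y_{j−1})^s·y_j − (y_{j−1}y_{j−2}⋯y_1·x_{2g}x_{2g−1}⋯x_{j+1})^s both belong to the two-sided ideal I. -/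
variable (K : Type*) [Field K]

/-- The free associative `K`-algebra `A = K⟨x_1, y_1, …, x_{2g}, y_{2g}⟩` on `4g`
noncommuting generators: `Sum.inl i` is `x_{i+1}` (standing for `c_{i+1}`) and
`Sum.inr i` is `y_{i+1}` (standing for `c_{i+1}⁻¹`). -/
abbrev SurfAlg (g : ℕ) : Type _ := FreeAlgebra K (Fin (2 * g) ⊕ Fin (2 * g))

/-- The generator `x_k` (1-based index `k`, for `1 ≤ k ≤ 2g`). -/
noncomputable def xg (g k : ℕ) : SurfAlg K g :=
  if h : k - 1 < 2 * g then FreeAlgebra.ι K (Sum.inl (⟨k - 1, h⟩ : Fin (2 * g))) else 0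

/-- The generator `y_k` (1-based index `k`, for `1 ≤ k ≤ 2g`). -/
noncomputable def yg (g k : ℕ) : SurfAlg K g :=
  if h : k - 1 < 2 * g then FreeAlgebra.ι K (Sum.inr (⟨k - 1, h⟩ : Fin (2 * g))) else 0

/-- The ascending word `x_a x_{a+1} ⋯ x_b`. -/
noncomputable def xUp (g a b : ℕ) : SurfAlg K g :=
  ((List.range' a (b + 1 - a)).map (xg K g)).prod

/-- The descending word `x_b x_{b-1} ⋯ x_a`. -/
noncomputable def xDown (g a b : ℕ) : SurfAlg K g :=
  ((List.range' a (b + 1 - a)).reverse.map (xg K g)).prod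

/-- The ascending word `y_a y_{a+1} ⋯ y_b`. -/
noncomputable def yUp (g a b : ℕ) : SurfAlg K g :=
  ((List.range' a (b + 1 - a)).map (yg K g)).prod

/-- The descending word `y_b y_{b-1} ⋯ y_a`. -/
noncomputable def yDown (g a b : ℕ) : SurfAlg K g :=
  ((List.range' a (b + 1 - a)).reverse.map (yg K g)).prod

/-- The generating set of the ideal `I` of the surface group with respect to the
presentation `⟨c_1, …, c_{2g} ∣ c_1⋯c_{2g} = c_{2g}⋯c_1⟩`:
it consists of `x_1x_2⋯x_{2g} − x_{2g}⋯x_1` and `x_iy_i − 1`, `y_ix_i − 1` for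
`i = 1, …, 2g`. -/
noncomputable def surfIdealGens (g : ℕ) : Set (SurfAlg K g) :=
  {xUp K g 1 (2 * g) - xDown K g 1 (2 * g)} ∪
    {p | ∃ i, 1 ≤ i ∧ i ≤ 2 * g ∧ p = xg K g i * yg K g i - 1} ∪
    {p | ∃ i, 1 ≤ i ∧ i ≤ 2 * g ∧ p = yg K g i * xg K g i - 1}

/-- The two-sided ideal `I` of the surface group `π₁(F_g)` with respect to the
presentation `⟨c_1, …, c_{2g} ∣ c_1⋯c_{2g} = c_{2g}⋯c_1⟩`. -/
noncomputable def surfIdeal (g : ℕ) : TwoSidedIdeal (SurfAlg K g) :=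
  TwoSidedIdeal.span (surfIdealGens K g)

/-- A product of elements of a monoid and the reversed product of right inverses cancel. -/
lemma List.prod_map_mul_prod_map_reverse_eq_one {ι M : Type*} [Monoid M] (u v : ι → M)
    (l : List ι) (h : ∀ i ∈ l, u i * v i = 1) :
    (l.map u).prod * (l.reverse.map v).prod = 1 := by
  induction l with
  | nil => simp
  | cons a l ih =>
    have ih' := ih fun i hi => h i (List.mem_cons_of_mem a hi)
    simp only [List.map_cons, List.prod_cons, List.reverse_cons, List.map_append,
      List.prod_append, List.map_nil, List.prod_nil, mul_one]
    calc u a * (l.map u).prod * ((l.reverse.map v).prod * v a)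
        = u a * ((l.map u).prod * (l.reverse.map v).prod) * v a := by simp only [mul_assoc]
      _ = 1 := by rw [ih', mul_one, h a List.mem_cons_self]

/-- The reversed product of elements of a monoid and the product of right inverses cancel. -/
lemma List.prod_map_reverse_mul_prod_map_eq_one {ι M : Type*} [Monoid M] (u v : ι → M)
    (l : List ι) (h : ∀ i ∈ l, u i * v i = 1) :
    (l.reverse.map u).prod * (l.map v).prod = 1 := by
  simpa using List.prod_map_mul_prod_map_reverse_eq_one u v l.reverse (by simpa using h)

/-- If `p x q = q' x p'` with `p'`, `q`, `q'` cancelled by one-sided inverses as indicated,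
then `x` conjugates powers of `p' q⁻¹` to powers of `q'⁻¹ p`. -/
lemma conj_pow_eq_of_mul_eq {M : Type*} [Monoid M] {x y p q p' q' r r' : M} (hxy : x * y = 1)
    (hr : q * r = 1) (hr' : r' * q' = 1) (h : p * x * q = q' * x * p') (s : ℕ) :
    x * (p' * r) ^ s * y = (r' * p) ^ s := by
  have key : SemiconjBy x (p' * r) (r' * p) := by
    calc x * (p' * r) = r' * q' * (x * (p' * r)) := by rw [hr', one_mul]
      _ = r' * (q' * x * p') * r := by simp only [mul_assoc]
      _ = r' * p * x * (q * r) := by rw [← h]; simp only [mul_assoc]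
      _ = r' * p * x := by rw [hr, mul_one]
  rw [(key.pow_right s).eq, mul_assoc, hxy, mul_one]

lemma range'_one_eq_append {n j : ℕ} (hj1 : 1 ≤ j) (hj2 : j ≤ n) :
    List.range' 1 n =
      List.range' 1 (j - 1) ++ j :: List.range' (j + 1) (n - j) := by
  obtain ⟨k, rfl⟩ := Nat.exists_eq_add_of_le' hj1
  obtain ⟨m, rfl⟩ := Nat.exists_eq_add_of_le hj2
  rw [← List.range'_succ, Nat.add_sub_cancel, Nat.add_sub_cancel_left, Nat.add_comm k 1,
    List.range'_append_1]
  congr 1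
  omega

lemma xUp_eq_mul (g j : ℕ) (hj1 : 1 ≤ j) (hj2 : j ≤ 2 * g) :
    xUp K g 1 (2 * g) = xUp K g 1 (j - 1) * xg K g j * xUp K g (j + 1) (2 * g) := by
  have h := range'_one_eq_append hj1 hj2
  simp [xUp, h, mul_assoc]

lemma xDown_eq_mul (g j : ℕ) (hj1 : 1 ≤ j) (hj2 : j ≤ 2 * g) :
    xDown K g 1 (2 * g) = xDown K g (j + 1) (2 * g) * xg K g j * xDown K g 1 (j - 1) := by
  have h := range'_one_eq_append hj1 hj2
  simp [xDown, h, mul_assoc]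

/-- For `g ≥ 2`, `2 ≤ j ≤ 2g` and `s ≥ 1`, the polynomials
`x_j (x_{j−1}⋯x_1 y_{2g}⋯y_{j+1})^s y_j − (y_{j+1}⋯y_{2g} x_1⋯x_{j−1})^s` and
`x_j (x_{j+1}⋯x_{2g} y_1⋯y_{j−1})^s y_j − (y_{j−1}⋯y_1 x_{2g}⋯x_{j+1})^s`
belong to the two-sided ideal `I`. -/
theorem statement_3 (g : ℕ) (hg : 2 ≤ g) (j s : ℕ) (hj1 : 2 ≤ j) (hj2 : j ≤ 2 * g)
    (hs : 1 ≤ s) :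
    xg K g j * (xDown K g 1 (j - 1) * yDown K g (j + 1) (2 * g)) ^ s * yg K g j -
        (yUp K g (j + 1) (2 * g) * xUp K g 1 (j - 1)) ^ s ∈ surfIdeal K g ∧
    xg K g j * (xUp K g (j + 1) (2 * g) * yUp K g 1 (j - 1)) ^ s * yg K g j -
        (yDown K g 1 (j - 1) * xDown K g (j + 1) (2 * g)) ^ s ∈ surfIdeal K g := by
  set π := (surfIdeal K g).ringCon.mk'
  have mem_iff (a b : SurfAlg K g) : a - b ∈ surfIdeal K g ↔ π a = π b := by
    rw [← TwoSidedIdeal.rel_iff]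
    exact (RingCon.eq _).symm
  have hxy (i : ℕ) (h1 : 1 ≤ i) (h2 : i ≤ 2 * g) : π (xg K g i) * π (yg K g i) = 1 := by
    rw [← map_mul, ← map_one π, ← mem_iff]
    exact TwoSidedIdeal.subset_span (Or.inl (Or.inr ⟨i, h1, h2, rfl⟩))
  have hyx (i : ℕ) (h1 : 1 ≤ i) (h2 : i ≤ 2 * g) : π (yg K g i) * π (xg K g i) = 1 := by
    rw [← map_mul, ← map_one π, ← mem_iff]
    exact TwoSidedIdeal.subset_span (Or.inr ⟨i, h1, h2, rfl⟩)
  have hrel : π (xUp K g 1 (j - 1)) * π (xg K g j) * π (xUp K g (j + 1) (2 * g)) =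
      π (xDown K g (j + 1) (2 * g)) * π (xg K g j) * π (xDown K g 1 (j - 1)) := by
    simp only [← map_mul]
    rw [← xUp_eq_mul K g j (by omega) hj2, ← xDown_eq_mul K g j (by omega) hj2, ← mem_iff]
    exact TwoSidedIdeal.subset_span (Or.inl (Or.inl rfl))
  have bound {a b i : ℕ} (ha : 1 ≤ a) (hb : b ≤ 2 * g) (hi : i ∈ List.range' a (b + 1 - a)) :
      1 ≤ i ∧ i ≤ 2 * g := by
    rw [List.mem_range'_1] at hi
    omega
  have up_down (a b : ℕ) (ha : 1 ≤ a) (hb : b ≤ 2 * g) :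
      π (xUp K g a b) * π (yDown K g a b) = 1 ∧ π (yDown K g a b) * π (xUp K g a b) = 1 := by
    simp only [xUp, yDown, map_list_prod, List.map_map]
    exact ⟨List.prod_map_mul_prod_map_reverse_eq_one _ _ _
        fun i hi => hxy i (bound ha hb hi).1 (bound ha hb hi).2,
      List.prod_map_reverse_mul_prod_map_eq_one _ _ _
        fun i hi => hyx i (bound ha hb hi).1 (bound ha hb hi).2⟩
  have down_up (a b : ℕ) (ha : 1 ≤ a) (hb : b ≤ 2 * g) :
      π (xDown K g a b) * π (yUp K g a b) = 1 ∧ π (yUp K g a b) * π (xDown K g a b) = 1 := by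
    simp only [xDown, yUp, map_list_prod, List.map_map]
    exact ⟨List.prod_map_reverse_mul_prod_map_eq_one _ _ _
        fun i hi => hxy i (bound ha hb hi).1 (bound ha hb hi).2,
      List.prod_map_mul_prod_map_reverse_eq_one _ _ _
        fun i hi => hyx i (bound ha hb hi).1 (bound ha hb hi).2⟩
  have hj := hxy j (by omega) hj2
  simp only [mem_iff, map_mul, map_pow]
  exact ⟨conj_pow_eq_of_mul_eq hj (up_down _ _ (by omega) le_rfl).1
      (down_up _ _ (by omega) le_rfl).2 hrel s,
    conj_pow_eq_of_mul_eq hj (down_up _ _ le_rfl (by omega)).1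
      (up_down _ _ le_rfl (by omega)).2 hrel.symm s⟩
end

section
/- Let g ≥ 2 and let K be a field. In the free associative algebra A = K⟨x_1, y_1, …, x_{2g}, y_{2g}⟩, the polynomial y_{2g}y_{2g−1}⋯y_1 − y_1y_2⋯y_{2g} belongs to the two-sided ideal I, and for every i with 2 ≤ i ≤ 2g the polynomials y_iy_{i+1}⋯y_{2g}·x_1x_2⋯x_{i−1} − x_{i−1}x_{i−2}⋯x_1·y_{2g}y_{2g−1}⋯y_i and y_{i−1}y_{i−2}⋯y_1·x_{2g}x_{2g−1}⋯x_i − x_ix_{i+1}⋯x_{2g}·y_1y_2⋯y_{i−1} both belong to I. -/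
variable (K : Type*) [Field K]

/-- Reversing a list and inverting its letters gives an inverse of the product. -/
theorem List.prod_map_mul_prod_reverse_map_eq_one {ι M : Type*} [Monoid M] (l : List ι)
    (f h : ι → M) (hfh : ∀ k ∈ l, f k * h k = 1) :
    (l.map f).prod * (l.reverse.map h).prod = 1 := by
  induction l with
  | nil => simp
  | cons a l ih =>
    have ih' := ih fun k hk => hfh k (List.mem_cons_of_mem a hk)
    simp only [List.map_cons, List.prod_cons, List.reverse_cons, List.map_append,
      List.prod_append, List.map_nil, List.prod_nil, mul_one]
    calc f a * (l.map f).prod * ((l.reverse.map h).prod * h a)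
        = f a * ((l.map f).prod * (l.reverse.map h).prod) * h a := by simp only [mul_assoc]
      _ = 1 := by rw [ih', mul_one, hfh a List.mem_cons_self]

theorem TwoSidedIdeal.sub_mem_iff_mk'_eq {R : Type*} [Ring R] (I : TwoSidedIdeal R) (a b : R) :
    a - b ∈ I ↔ I.ringCon.mk' a = I.ringCon.mk' b := by
  rw [← TwoSidedIdeal.rel_iff]
  exact (RingCon.eq I.ringCon).symm

/-- In a monoid, `a * b = c * d` implies `c' * a = d * b'` when `c'` is a left inverse of `c` and
`b'` a right inverse of `b`. -/
theorem mul_eq_mul_of_mul_eq_mul_of_inverses {M : Type*} [Monoid M] {a b c d b' c' : M}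
    (h : a * b = c * d) (hb : b * b' = 1) (hc : c' * c = 1) : c' * a = d * b' :=
  calc c' * a = c' * (a * b) * b' := by rw [mul_assoc, mul_assoc, hb, mul_one]
    _ = d * b' := by rw [h, ← mul_assoc c', hc, one_mul]

theorem List.range'_one_append_range' {i n : ℕ} (hi : 1 ≤ i) (hin : i ≤ n) :
    List.range' 1 (n + 1 - 1) =
      List.range' 1 (i - 1 + 1 - 1) ++ List.range' i (n + 1 - i) := by
  have h := List.range'_append (s := 1) (m := i - 1) (n := n + 1 - i) (step := 1)
  rw [show 1 + 1 * (i - 1) = i by omega, show i - 1 + (n + 1 - i) = n + 1 - 1 by omega] at h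
  rw [← h, Nat.add_sub_cancel]

theorem xUp_mul_xUp {g i : ℕ} (hi : 1 ≤ i) (hig : i ≤ 2 * g) :
    xUp K g 1 (i - 1) * xUp K g i (2 * g) = xUp K g 1 (2 * g) := by
  simp only [xUp, List.range'_one_append_range' hi hig, List.map_append, List.prod_append]

theorem xDown_mul_xDown {g i : ℕ} (hi : 1 ≤ i) (hig : i ≤ 2 * g) :
    xDown K g i (2 * g) * xDown K g 1 (i - 1) = xDown K g 1 (2 * g) := by
  simp only [xDown, List.range'_one_append_range' hi hig, List.reverse_append, List.map_append,
    List.prod_append]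

section Quotient

variable {K} {R : Type*} [Ring R] {g : ℕ} (φ : SurfAlg K g →+* R) {a b : ℕ}

theorem map_xUp_mul_map_yDown (h : ∀ k, a ≤ k → k ≤ b → φ (xg K g k) * φ (yg K g k) = 1) :
    φ (xUp K g a b) * φ (yDown K g a b) = 1 := by
  simp only [xUp, yDown, map_list_prod, List.map_map]
  refine List.prod_map_mul_prod_reverse_map_eq_one _ _ _ fun k hk => ?_
  rw [List.mem_range'_1] at hk
  exact h k (by omega) (by omega)

theorem map_yDown_mul_map_xUp (h : ∀ k, a ≤ k → k ≤ b → φ (yg K g k) * φ (xg K g k) = 1) :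
    φ (yDown K g a b) * φ (xUp K g a b) = 1 := by
  simp only [xUp, yDown, map_list_prod, List.map_map]
  have := List.prod_map_mul_prod_reverse_map_eq_one (List.range' a (b + 1 - a)).reverse
    (φ ∘ yg K g) (φ ∘ xg K g) fun k hk => by
      rw [List.mem_reverse, List.mem_range'_1] at hk
      exact h k (by omega) (by omega)
  rwa [List.reverse_reverse] at this

theorem map_yUp_mul_map_xDown (h : ∀ k, a ≤ k → k ≤ b → φ (yg K g k) * φ (xg K g k) = 1) :
    φ (yUp K g a b) * φ (xDown K g a b) = 1 := by
  simp only [yUp, xDown, map_list_prod, List.map_map]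
  refine List.prod_map_mul_prod_reverse_map_eq_one _ _ _ fun k hk => ?_
  rw [List.mem_range'_1] at hk
  exact h k (by omega) (by omega)

theorem map_xDown_mul_map_yUp (h : ∀ k, a ≤ k → k ≤ b → φ (xg K g k) * φ (yg K g k) = 1) :
    φ (xDown K g a b) * φ (yUp K g a b) = 1 := by
  simp only [yUp, xDown, map_list_prod, List.map_map]
  have := List.prod_map_mul_prod_reverse_map_eq_one (List.range' a (b + 1 - a)).reverse
    (φ ∘ xg K g) (φ ∘ yg K g) fun k hk => by
      rw [List.mem_reverse, List.mem_range'_1] at hk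
      exact h k (by omega) (by omega)
  rwa [List.reverse_reverse] at this

end Quotient

/-- For `g ≥ 2`, the polynomial `y_{2g}y_{2g−1}⋯y_1 − y_1y_2⋯y_{2g}` belongs to the
two-sided ideal `I`, and for every `2 ≤ i ≤ 2g` the polynomials
`y_iy_{i+1}⋯y_{2g}·x_1⋯x_{i−1} − x_{i−1}⋯x_1·y_{2g}⋯y_i` and
`y_{i−1}⋯y_1·x_{2g}⋯x_i − x_i⋯x_{2g}·y_1⋯y_{i−1}` belong to `I`. -/
theorem statement_4 (g : ℕ) (hg : 2 ≤ g) :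
    yDown K g 1 (2 * g) - yUp K g 1 (2 * g) ∈ surfIdeal K g ∧
    ∀ i, 2 ≤ i → i ≤ 2 * g →
      yUp K g i (2 * g) * xUp K g 1 (i - 1) -
          xDown K g 1 (i - 1) * yDown K g i (2 * g) ∈ surfIdeal K g ∧
      yDown K g 1 (i - 1) * xDown K g i (2 * g) -
          xUp K g i (2 * g) * yUp K g 1 (i - 1) ∈ surfIdeal K g := by
  simp only [TwoSidedIdeal.sub_mem_iff_mk'_eq, map_mul]
  have gens {p q : SurfAlg K g} (h : p - q ∈ surfIdealGens K g) :
      (surfIdeal K g).ringCon.mk' p = (surfIdeal K g).ringCon.mk' q :=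
    (TwoSidedIdeal.sub_mem_iff_mk'_eq _ _ _).1 (TwoSidedIdeal.subset_span h)
  have hrel := gens (.inl (.inl rfl))
  have hxy (k : ℕ) (h1 : 1 ≤ k) (h2 : k ≤ 2 * g) := gens (.inl (.inr ⟨k, h1, h2, rfl⟩))
  have hyx (k : ℕ) (h1 : 1 ≤ k) (h2 : k ≤ 2 * g) := gens (.inr ⟨k, h1, h2, rfl⟩)
  simp only [map_mul, map_one] at hxy hyx
  generalize (surfIdeal K g).ringCon.mk' = φ at *
  refine ⟨?_, fun i hi hig => ?_⟩
  · have hl := map_yDown_mul_map_xUp φ hyx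
    rw [hrel] at hl
    exact left_inv_eq_right_inv hl (map_xDown_mul_map_yUp φ hxy)
  · have hsplit : φ (xUp K g 1 (i - 1)) * φ (xUp K g i (2 * g)) =
        φ (xDown K g i (2 * g)) * φ (xDown K g 1 (i - 1)) := by
      rw [← map_mul, ← map_mul, xUp_mul_xUp K (by omega) hig, xDown_mul_xDown K (by omega) hig,
        hrel]
    constructor
    · exact mul_eq_mul_of_mul_eq_mul_of_inverses hsplit
        (map_xUp_mul_map_yDown φ fun k h1 h2 => hxy k (by omega) h2)
        (map_yUp_mul_map_xDown φ fun k h1 h2 => hyx k (by omega) h2)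
    · exact mul_eq_mul_of_mul_eq_mul_of_inverses hsplit.symm
        (map_xDown_mul_map_yUp φ fun k h1 h2 => hxy k h1 (by omega))
        (map_yDown_mul_map_xUp φ fun k h1 h2 => hyx k h1 (by omega))
end

section
/- Let g ≥ 2 and let α = a_1a_2⋯a_k be a word in the letters c_i^{±1}. Then α is D-reducible (i.e., some contiguous subword of α belongs to the set L of leading words) if and only if its formal inverse a_k⁻¹⋯a_2⁻¹a_1⁻¹ is D-reducible. -/
/-- A letter `(k, true)` stands for `c_k` and `(k, false)` stands for `c_k⁻¹`
(1-based index `k`, for `1 ≤ k ≤ 2g`). A word is a list of letters. -/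
abbrev SLetter : Type := ℕ × Bool

/-- The inverse of a letter: `(c_k)⁻¹ = c_k⁻¹` and `(c_k⁻¹)⁻¹ = c_k`. -/
def letterInv (a : SLetter) : SLetter := (a.1, !a.2)

/-- The formal inverse of a word `a_1 a_2 ⋯ a_k`, namely `a_k⁻¹ ⋯ a_2⁻¹ a_1⁻¹`. -/
def wordInv (w : List SLetter) : List SLetter := w.reverse.map letterInv

/-- The ascending word `c_a c_{a+1} ⋯ c_b`. -/
def wUp (a b : ℕ) : List SLetter := (List.range' a (b + 1 - a)).map fun k => (k, true)

/-- The descending word `c_b c_{b-1} ⋯ c_a`. -/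
def wDown (a b : ℕ) : List SLetter :=
  (List.range' a (b + 1 - a)).reverse.map fun k => (k, true)

/-- The ascending word of inverses `c_a⁻¹ c_{a+1}⁻¹ ⋯ c_b⁻¹`. -/
def wUpInv (a b : ℕ) : List SLetter := (List.range' a (b + 1 - a)).map fun k => (k, false)

/-- The descending word of inverses `c_b⁻¹ c_{b-1}⁻¹ ⋯ c_a⁻¹`. -/
def wDownInv (a b : ℕ) : List SLetter :=
  (List.range' a (b + 1 - a)).reverse.map fun k => (k, false)

/-- The `s`-th power `w^s = w w ⋯ w` of a word. -/
def wordPow (w : List SLetter) (s : ℕ) : List SLetter := (List.replicate s w).flatten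

/-- The leading word `c_j (c_{j−1}⋯c_1 c_{2g}⁻¹⋯c_{j+1}⁻¹)^s c_j⁻¹`. -/
def lead1 (g j s : ℕ) : List SLetter :=
  [((j : ℕ), true)] ++ wordPow (wDown 1 (j - 1) ++ wDownInv (j + 1) (2 * g)) s ++ [(j, false)]

/-- The leading word `c_j (c_{j+1}⋯c_{2g} c_1⁻¹⋯c_{j−1}⁻¹)^s c_j⁻¹`. -/
def lead2 (g j s : ℕ) : List SLetter :=
  [((j : ℕ), true)] ++ wordPow (wUp (j + 1) (2 * g) ++ wUpInv 1 (j - 1)) s ++ [(j, false)]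

/-- The leading word `c_{2g}⁻¹ c_{2g−1}⁻¹ ⋯ c_1⁻¹`. -/
def lead3 (g : ℕ) : List SLetter := wDownInv 1 (2 * g)

/-- The leading word `c_1 c_2 ⋯ c_{2g}`. -/
def lead4 (g : ℕ) : List SLetter := wUp 1 (2 * g)

/-- The leading word `c_i⁻¹ c_{i+1}⁻¹ ⋯ c_{2g}⁻¹ c_1 c_2 ⋯ c_{i−1}`. -/
def lead5 (g i : ℕ) : List SLetter := wUpInv i (2 * g) ++ wUp 1 (i - 1)

/-- The leading word `c_{i−1}⁻¹ c_{i−2}⁻¹ ⋯ c_1⁻¹ c_{2g} c_{2g−1} ⋯ c_i`. -/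
def lead6 (g i : ℕ) : List SLetter := wDownInv 1 (i - 1) ++ wDown i (2 * g)

/-- The leading word `c_i⁻¹ c_i`. -/
def lead7 (i : ℕ) : List SLetter := [(i, false), (i, true)]

/-- The leading word `c_i c_i⁻¹`. -/
def lead8 (i : ℕ) : List SLetter := [(i, true), (i, false)]

/-- The set `L` of leading words of the Gröbner–Shirshov basis `D`. -/
def LeadingWords (g : ℕ) : Set (List SLetter) :=
  {w | (∃ j s, 2 ≤ j ∧ j ≤ 2 * g ∧ 1 ≤ s ∧ (w = lead1 g j s ∨ w = lead2 g j s)) ∨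
       w = lead3 g ∨ w = lead4 g ∨
       (∃ i, 2 ≤ i ∧ i ≤ 2 * g ∧ (w = lead5 g i ∨ w = lead6 g i)) ∨
       (∃ i, 1 ≤ i ∧ i ≤ 2 * g ∧ (w = lead7 i ∨ w = lead8 i))}

/-- A word is `D`-reducible if some contiguous subword of it is a leading word. -/
def DReducible (g : ℕ) (w : List SLetter) : Prop :=
  ∃ u ∈ LeadingWords g, u <:+: w

theorem letterInv_letterInv (a : SLetter) : letterInv (letterInv a) = a := by
  simp [letterInv]

theorem wordInv_append (u v : List SLetter) : wordInv (u ++ v) = wordInv v ++ wordInv u := by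
  simp [wordInv]

theorem wordInv_wordInv (w : List SLetter) : wordInv (wordInv w) = w := by
  simp [wordInv, Function.comp_def, letterInv_letterInv]

theorem wordInv_singleton (a : SLetter) : wordInv [a] = [letterInv a] := rfl

theorem wordInv_wordPow (w : List SLetter) (s : ℕ) :
    wordInv (wordPow w s) = wordPow (wordInv w) s := by
  simp [wordInv, wordPow, List.reverse_flatten, List.map_flatten]

theorem wordInv_wUp (a b : ℕ) : wordInv (wUp a b) = wDownInv a b := by
  simp [wordInv, wUp, wDownInv, letterInv, Function.comp_def]

theorem wordInv_wDown (a b : ℕ) : wordInv (wDown a b) = wUpInv a b := by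
  simp [wordInv, wDown, wUpInv, letterInv, Function.comp_def]

theorem wordInv_wUpInv (a b : ℕ) : wordInv (wUpInv a b) = wDown a b := by
  rw [← wordInv_wDown, wordInv_wordInv]

theorem wordInv_wDownInv (a b : ℕ) : wordInv (wDownInv a b) = wUp a b := by
  rw [← wordInv_wUp, wordInv_wordInv]

theorem wordInv_lead1 (g j s : ℕ) : wordInv (lead1 g j s) = lead2 g j s := by
  simp only [lead1, lead2, wordInv_append, wordInv_wordPow, wordInv_singleton, wordInv_wDown,
    wordInv_wDownInv, letterInv, Bool.not_true, Bool.not_false, List.append_assoc]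

theorem wordInv_lead2 (g j s : ℕ) : wordInv (lead2 g j s) = lead1 g j s := by
  rw [← wordInv_lead1, wordInv_wordInv]

theorem wordInv_lead5 (g i : ℕ) : wordInv (lead5 g i) = lead6 g i := by
  rw [lead5, lead6, wordInv_append, wordInv_wUp, wordInv_wUpInv]

theorem wordInv_lead6 (g i : ℕ) : wordInv (lead6 g i) = lead5 g i := by
  rw [← wordInv_lead5, wordInv_wordInv]

/-- The set of leading words is closed under formal inversion. -/
theorem wordInv_mem_leadingWords {g : ℕ} {w : List SLetter} (hw : w ∈ LeadingWords g) :
    wordInv w ∈ LeadingWords g := by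
  rcases hw with ⟨j, s, hj, hj', hs, rfl | rfl⟩ | rfl | rfl | ⟨i, hi, hi', rfl | rfl⟩ |
    ⟨i, hi, hi', rfl | rfl⟩
  · exact Or.inl ⟨j, s, hj, hj', hs, Or.inr (wordInv_lead1 g j s)⟩
  · exact Or.inl ⟨j, s, hj, hj', hs, Or.inl (wordInv_lead2 g j s)⟩
  · exact Or.inr (Or.inr (Or.inl (wordInv_wDownInv 1 (2 * g))))
  · exact Or.inr (Or.inl (wordInv_wUp 1 (2 * g)))
  · exact Or.inr (Or.inr (Or.inr (Or.inl ⟨i, hi, hi', Or.inr (wordInv_lead5 g i)⟩)))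
  · exact Or.inr (Or.inr (Or.inr (Or.inl ⟨i, hi, hi', Or.inl (wordInv_lead6 g i)⟩)))
  · exact Or.inr (Or.inr (Or.inr (Or.inr ⟨i, hi, hi', Or.inl rfl⟩)))
  · exact Or.inr (Or.inr (Or.inr (Or.inr ⟨i, hi, hi', Or.inr rfl⟩)))

theorem DReducible.wordInv {g : ℕ} {w : List SLetter} (hw : DReducible g w) :
    DReducible g (wordInv w) := by
  obtain ⟨u, hu, huw⟩ := hw
  exact ⟨_, wordInv_mem_leadingWords hu, (List.reverse_infix.2 huw).map letterInv⟩

/-- A word `α = a_1⋯a_k` in the letters `c_i^{±1}` (`1 ≤ i ≤ 2g`) is `D`-reducible if and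
only if its formal inverse `a_k⁻¹⋯a_1⁻¹` is `D`-reducible. -/
theorem statement_7 (g : ℕ) (hg : 2 ≤ g) (α : List SLetter)
    (hα : ∀ a ∈ α, 1 ≤ a.1 ∧ a.1 ≤ 2 * g) :
    DReducible g α ↔ DReducible g (wordInv α) := by
  exact ⟨DReducible.wordInv, fun h => wordInv_wordInv α ▸ h.wordInv⟩
end

section
/- Let g ≥ 2 and let α = a_1a_2⋯a_s be a word in the letters c_i^{±1}. Then α is cyclically D-reduced (i.e., every cyclic rotation a_t a_{t+1}⋯a_s a_1⋯a_{t−1} of α is D-reduced) if and only if the word α² = a_1⋯a_s a_1⋯a_s is D-reduced. -/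
/-- The first letter of a leading word does not occur again in it. -/
theorem exists_cons_notMem_of_mem_leadingWords {g : ℕ} (hg : 2 ≤ g) {u : List SLetter}
    (hu : u ∈ LeadingWords g) : ∃ a v, u = a :: v ∧ a ∉ v := by
  have of_nodup : ∀ w : List SLetter, w ≠ [] → w.Nodup → ∃ a v, w = a :: v ∧ a ∉ v := by
    intro w hw hn
    obtain ⟨a, v, rfl⟩ := List.exists_cons_of_ne_nil hw
    exact ⟨a, v, rfl, (List.nodup_cons.1 hn).1⟩
  have inj : ∀ b : Bool, Function.Injective fun k : ℕ => (k, b) :=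
    fun b x y h => congrArg Prod.fst h
  rcases hu with ⟨j, s, hj, hj', hs, rfl | rfl⟩ | rfl | rfl | ⟨i, hi, hi', rfl | rfl⟩ |
    ⟨i, hi, hi', rfl | rfl⟩
  · refine ⟨(j, true), _, rfl, ?_⟩
    simp [wordPow, wDown, wDownInv, List.mem_range'_1]
    omega
  · refine ⟨(j, true), _, rfl, ?_⟩
    simp [wordPow, wUp, wUpInv, List.mem_range'_1]
  · apply of_nodup
    · simp [lead3, wDownInv]; omega
    · exact (List.nodup_reverse.2 List.nodup_range').map (inj _)
  · apply of_nodup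
    · simp [lead4, wUp]; omega
    · exact List.Nodup.map (inj _) List.nodup_range'
  · apply of_nodup
    · simp [lead5, wUpInv]; omega
    · refine (List.Nodup.map (inj _) List.nodup_range').append
        (List.Nodup.map (inj _) List.nodup_range') ?_
      simp [List.disjoint_left, wUp]
  · apply of_nodup
    · simp [lead6, wDownInv, wDown]; omega
    · refine ((List.nodup_reverse.2 List.nodup_range').map (inj _)).append
        ((List.nodup_reverse.2 List.nodup_range').map (inj _)) ?_
      simp [List.disjoint_left, wDown]
  · exact ⟨_, _, rfl, by simp⟩
  · exact ⟨_, _, rfl, by simp⟩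

/-- A subword of `l ++ l` whose first letter does not recur is a subword of a rotation of `l`. -/
theorem exists_cons_infix_rotation_of_infix_append_self {β : Type*} {a : β} {v l : List β}
    (ha : a ∉ v) (h : a :: v <:+: l ++ l) :
    ∃ t, t < l.length ∧ a :: v <:+: l.drop t ++ l.take t := by
  obtain ⟨x, y, hxy⟩ := h
  have hlen := congrArg List.length hxy
  simp only [List.length_append, List.length_cons] at hlen
  rw [List.append_assoc] at hxy
  have hdrop : (l ++ l).drop x.length = a :: v ++ y := by rw [← hxy, List.drop_left]
  rcases lt_or_ge x.length l.length with hx | hx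
  · refine ⟨x.length, hx, ?_⟩
    rw [List.drop_append_of_le_length hx.le] at hdrop
    have hv : v.length + 1 ≤ l.length := by
      by_contra! hlt
      have h₀ : (l.drop x.length ++ l)[0]? = some a := by simp [hdrop]
      have h₁ : (l.drop x.length ++ l)[l.length]? = v[l.length - 1]? := by
        rw [hdrop, List.getElem?_append_left (by simp; omega), List.getElem?_cons]
        rw [if_neg (by omega)]
      rw [List.getElem?_append_left (by simp; omega)] at h₀
      rw [List.getElem?_append_right (by simp)] at h₁
      simp only [List.getElem?_drop, List.length_drop] at h₀ h₁
      rw [show l.length - (l.length - x.length) = x.length + 0 by omega, h₀] at h₁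
      exact ha (List.mem_of_getElem? h₁.symm)
    refine List.IsPrefix.isInfix (List.prefix_of_prefix_length_le (l₃ := l.drop x.length ++ l)
      ⟨y, hdrop.symm⟩ ?_ ?_)
    · exact (List.prefix_append_right_inj _).2 (List.take_prefix _ _)
    · simp; omega
  · refine ⟨0, by omega, ?_⟩
    rw [List.drop_append, List.drop_eq_nil_of_le hx, List.nil_append] at hdrop
    simp only [List.drop_zero, List.take_zero, List.append_nil]
    exact (List.prefix_append _ y).isInfix.trans (hdrop ▸ (List.drop_suffix _ _).isInfix)

/-- A word `α = a_1⋯a_s` in the letters `c_i^{±1}` (`1 ≤ i ≤ 2g`) is cyclically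
`D`-reduced (every cyclic rotation of `α` is `D`-reduced) if and only if `α²` is
`D`-reduced. -/
theorem statement_8 (g : ℕ) (hg : 2 ≤ g) (α : List SLetter)
    (hα : ∀ a ∈ α, 1 ≤ a.1 ∧ a.1 ≤ 2 * g) :
    (∀ t, t < α.length → ¬ DReducible g (α.drop t ++ α.take t)) ↔
      ¬ DReducible g (α ++ α) := by
  constructor
  · rintro h ⟨u, hu, hinf⟩
    obtain ⟨a, v, rfl, ha⟩ := exists_cons_notMem_of_mem_leadingWords hg hu
    obtain ⟨t, ht, hrot⟩ := exists_cons_infix_rotation_of_infix_append_self ha hinf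
    exact h t ht ⟨_, hu, hrot⟩
  · rintro h t - ⟨u, hu, hinf⟩
    refine h ⟨u, hu, hinf.trans ⟨α.take t, α.drop t, ?_⟩⟩
    rw [← List.append_assoc, List.take_append_drop, List.append_assoc, List.take_append_drop]
end

section
/- Let g ≥ 2. Define ϑ_g : {1, …, 2g} × {1, −1} → ℤ/4gℤ by ϑ_g(j, 1) = j − 1 + (1 − (−1)^j)·g and ϑ_g(j, −1) = j − 1 + (1 + (−1)^j)·g (mod 4g). Then: (a) ϑ_g is a bijection; and (b) for any letters w_1, w_2, w_3 ∈ {1, …, 2g} × {1, −1} and signs ε_1, ε_2, ε_3 ∈ {1, −1} such that the three letters w_1^{ε_1}, w_2^{ε_2}, w_3^{ε_3} are pairwise distinct (where (j, η)^{ε} := (j, ηε)), one has Θ(ε_1·T(w_1), ε_2·T(w_2), ε_3·T(w_3)) = sgn(ϑ_g(w_1^{ε_1}), ϑ_g(w_2^{ε_2}), ϑ_g(w_3^{ε_3})). -/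
open Real

/-- The point `T(w) = η·(−1)^j·e^{(j−1)πi/(2g)}` on the unit circle associated to the
letter `w = c_j^η` (with `1 ≤ j ≤ 2g` and `η ∈ {1, −1}`). -/
noncomputable def Tlet (g j : ℕ) (η : ℤ) : ℂ :=
  (η : ℂ) * (-1) ^ j * Complex.exp (((j : ℂ) - 1) * π * Complex.I / (2 * g))

/-- The map `ϑ_g : {1, …, 2g} × {1, −1} → ℤ/4gℤ`,
`ϑ_g(j, ε) = j − 1 + (1 − ε·(−1)^j)·g`; for `ε = 1` this is `j − 1 + (1 − (−1)^j)·g` and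
for `ε = −1` it is `j − 1 + (1 + (−1)^j)·g`. -/
def thetaMap (g j : ℕ) (ε : ℤ) : ZMod (4 * g) :=
  (((j : ℤ) - 1 + (1 - ε * (-1) ^ j) * g : ℤ) : ZMod (4 * g))

/-- For distinct points `P, W` on the unit circle, the unique angle `θ_W ∈ (0, 2π)` with
`W = P·e^{iθ_W}`. -/
noncomputable def angleFrom (P W : ℂ) : ℝ :=
  if 0 < (W / P).arg then (W / P).arg else (W / P).arg + 2 * π

/-- For pairwise distinct points `P, Q, R` on the unit circle: `Θ(P, Q, R) = 1` if
`θ_Q < θ_R` and `Θ(P, Q, R) = −1` if `θ_Q > θ_R`, i.e. `Θ(P, Q, R) = 1` exactly when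
`P, Q, R` occur in counterclockwise cyclic order. -/
noncomputable def Theta3 (P Q R : ℂ) : ℤ :=
  if angleFrom P Q < angleFrom P R then 1 else -1

/-- For pairwise distinct `a, b, c ∈ ℤ/nℤ`: `sgn(a, b, c) = 1` if
`rep(b − a) < rep(c − a)` and `−1` otherwise, where `rep` is the representative in
`{1, …, n − 1}` of a nonzero element. -/
def sgn3 (n : ℕ) (a b c : ZMod n) : ℤ :=
  if (b - a).val < (c - a).val then 1 else -1

/-- The integer lift in `[0, 4g)` of `thetaMap g j e`. -/
def letterIndex (g j : ℕ) (e : ℤ) : ℤ :=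
  (j : ℤ) - 1 + (1 - e * (-1) ^ j) * g

theorem thetaMap_eq_intCast_letterIndex (g j : ℕ) (e : ℤ) :
    thetaMap g j e = (letterIndex g j e : ZMod (4 * g)) := rfl

theorem sign_mul_sign {a b : ℤ} (ha : a = 1 ∨ a = -1) (hb : b = 1 ∨ b = -1) :
    a * b = 1 ∨ a * b = -1 := by
  rcases ha with rfl | rfl <;> rcases hb with rfl | rfl <;> simp

theorem letterIndex_cases {g j : ℕ} {e : ℤ} (he : e = 1 ∨ e = -1) :
    (e = (-1) ^ j ∧ letterIndex g j e = j - 1) ∨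
      (e = -(-1) ^ j ∧ letterIndex g j e = j - 1 + 2 * g) := by
  unfold letterIndex
  rcases he with rfl | rfl <;> rcases neg_one_pow_eq_or ℤ j with h | h <;> rw [h] <;>
    norm_num

theorem letterIndex_mem_Ico {g j : ℕ} {e : ℤ} (hj : 1 ≤ j) (hjg : j ≤ 2 * g)
    (he : e = 1 ∨ e = -1) : 0 ≤ letterIndex g j e ∧ letterIndex g j e < 4 * g := by
  rcases letterIndex_cases (g := g) (j := j) he with ⟨-, h⟩ | ⟨-, h⟩ <;> rw [h] <;> omega

theorem letterIndex_injective {g j j' : ℕ} {e e' : ℤ} (hj : 1 ≤ j) (hjg : j ≤ 2 * g)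
    (hj' : 1 ≤ j') (hjg' : j' ≤ 2 * g) (he : e = 1 ∨ e = -1) (he' : e' = 1 ∨ e' = -1)
    (h : letterIndex g j e = letterIndex g j' e') : (j, e) = (j', e') := by
  rcases letterIndex_cases (g := g) (j := j) he with ⟨h₁, h₂⟩ | ⟨h₁, h₂⟩ <;>
    rcases letterIndex_cases (g := g) (j := j') he' with ⟨h₃, h₄⟩ | ⟨h₃, h₄⟩ <;>
    rw [h₂, h₄] at h
  · obtain rfl : j = j' := by omega
    rw [h₁, h₃]
  · omega
  · omega
  · obtain rfl : j = j' := by omega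
    rw [h₁, h₃]

theorem thetaMap_injective {g j j' : ℕ} {e e' : ℤ} (hj : 1 ≤ j) (hjg : j ≤ 2 * g)
    (hj' : 1 ≤ j') (hjg' : j' ≤ 2 * g) (he : e = 1 ∨ e = -1) (he' : e' = 1 ∨ e' = -1)
    (h : thetaMap g j e = thetaMap g j' e') : (j, e) = (j', e') := by
  refine letterIndex_injective hj hjg hj' hjg' he he' ?_
  rw [thetaMap_eq_intCast_letterIndex, thetaMap_eq_intCast_letterIndex,
    ZMod.intCast_eq_intCast_iff'] at h
  obtain ⟨h₀, h₁⟩ := letterIndex_mem_Ico hj hjg he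
  obtain ⟨h₀', h₁'⟩ := letterIndex_mem_Ico hj' hjg' he'
  push_cast at h
  rwa [Int.emod_eq_of_lt h₀ h₁, Int.emod_eq_of_lt h₀' h₁'] at h

theorem exists_thetaMap_eq {g : ℕ} (hg : 0 < g) (v : ZMod (4 * g)) :
    ∃ (j : ℕ) (e : ℤ), (1 ≤ j ∧ j ≤ 2 * g ∧ (e = 1 ∨ e = -1)) ∧ thetaMap g j e = v := by
  have : NeZero (4 * g) := ⟨by omega⟩
  have hv := ZMod.val_lt v
  have hcast : ((v.val : ℤ) : ZMod (4 * g)) = v := by simp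
  have hsq (j : ℕ) : ((-1 : ℤ) ^ j) * (-1) ^ j = 1 := by rw [← mul_pow]; simp
  rcases lt_or_ge v.val (2 * g) with h | h
  · refine ⟨v.val + 1, (-1) ^ (v.val + 1), ⟨by omega, by omega, neg_one_pow_eq_or ℤ _⟩, ?_⟩
    rw [thetaMap_eq_intCast_letterIndex, letterIndex, hsq]
    simp
  · refine ⟨v.val - 2 * g + 1, -(-1) ^ (v.val - 2 * g + 1), ⟨by omega, by omega, ?_⟩, ?_⟩
    · rcases neg_one_pow_eq_or ℤ (v.val - 2 * g + 1) with h | h <;> simp [h]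
    · rw [thetaMap_eq_intCast_letterIndex, letterIndex, neg_mul, hsq]
      refine Eq.trans ?_ hcast
      congr 1
      push_cast [h]
      ring

theorem sign_mul_Tlet {g j : ℕ} {η ε : ℤ} (hg : 0 < g) (hη : η = 1 ∨ η = -1)
    (hε : ε = 1 ∨ ε = -1) :
    (ε : ℂ) * Tlet g j η =
      Complex.exp ((2 * π * letterIndex g j (η * ε) / (4 * g : ℕ) : ℝ) * Complex.I) := by
  have hgC : (g : ℂ) ≠ 0 := by exact_mod_cast hg.ne'
  have key : (ε : ℂ) * Tlet g j η = ((η * ε : ℤ) : ℂ) * (-1) ^ j *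
      Complex.exp (((j : ℂ) - 1) * π * Complex.I / (2 * g)) := by
    rw [Tlet]; push_cast; ring
  have hsq : ((-1 : ℂ) ^ j) * (-1) ^ j = 1 := by rw [← mul_pow]; simp
  rw [key]
  rcases letterIndex_cases (g := g) (j := j) (sign_mul_sign hη hε) with ⟨h₁, h₂⟩ | ⟨h₁, h₂⟩
  · rw [h₂, h₁]
    push_cast
    rw [hsq, one_mul]
    congr 1
    field_simp
    ring
  · rw [h₂, h₁]
    push_cast
    rw [neg_mul, hsq, neg_one_mul, ← Complex.exp_add_pi_mul_I]
    congr 1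
    field_simp
    ring

theorem angleFrom_mul_exp {P : ℂ} (hP : P ≠ 0) {θ : ℝ} (h₀ : 0 < θ) (h₁ : θ < 2 * π) :
    angleFrom P (P * Complex.exp (θ * Complex.I)) = θ := by
  rw [angleFrom, mul_div_cancel_left₀ _ hP]
  rcases le_or_gt θ π with h | h
  · have harg : (Complex.exp (θ * Complex.I)).arg = θ := by
      rw [Complex.arg_exp_mul_I, toIocMod_eq_self]
      constructor <;> linarith [pi_pos]
    rw [harg, if_pos h₀]
  · have harg : (Complex.exp (θ * Complex.I)).arg = θ - 2 * π := by
      rw [Complex.arg_exp_mul_I, ← toIocMod_sub, toIocMod_eq_self]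
      constructor <;> linarith
    rw [harg, if_neg (by linarith), sub_add_cancel]

theorem angleFrom_exp_intCast {n : ℕ} [NeZero n] {a b : ℤ} (hab : (a : ZMod n) ≠ b) :
    angleFrom (Complex.exp ((2 * π * a / n : ℝ) * Complex.I))
        (Complex.exp ((2 * π * b / n : ℝ) * Complex.I)) =
      2 * π * ((b : ZMod n) - a).val / n := by
  have hn : (0 : ℝ) < n := by exact_mod_cast NeZero.pos n
  have hnC : (n : ℂ) ≠ 0 := by exact_mod_cast hn.ne'
  set m := ((b : ZMod n) - a).val with hm
  have hm₀ : 0 < m := ZMod.val_pos.2 (sub_ne_zero.2 hab.symm)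
  have hm₁ : m < n := ZMod.val_lt _
  obtain ⟨k, hk⟩ : (n : ℤ) ∣ b - a - m := by
    rw [← ZMod.intCast_zmod_eq_zero_iff_dvd]
    push_cast
    rw [hm, ZMod.natCast_zmod_val, sub_self]
  have hb : (b : ℂ) = a + m + n * k := by
    exact_mod_cast (by linarith : b = a + m + n * k)
  have hexp : Complex.exp ((2 * π * b / n : ℝ) * Complex.I) =
      Complex.exp ((2 * π * a / n : ℝ) * Complex.I) *
        Complex.exp ((2 * π * m / n : ℝ) * Complex.I) := by
    rw [← Complex.exp_add, Complex.exp_eq_exp_iff_exists_int]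
    refine ⟨k, ?_⟩
    push_cast
    rw [hb]
    field_simp
  rw [hexp]
  apply angleFrom_mul_exp (Complex.exp_ne_zero _)
  · have : (0 : ℝ) < m := by exact_mod_cast hm₀
    positivity
  · rw [div_lt_iff₀ hn]
    have : (m : ℝ) < n := by exact_mod_cast hm₁
    gcongr

theorem Theta3_exp_intCast {n : ℕ} [NeZero n] {a b c : ℤ} (hab : (a : ZMod n) ≠ b)
    (hac : (a : ZMod n) ≠ c) :
    Theta3 (Complex.exp ((2 * π * a / n : ℝ) * Complex.I))
        (Complex.exp ((2 * π * b / n : ℝ) * Complex.I))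
        (Complex.exp ((2 * π * c / n : ℝ) * Complex.I)) =
      sgn3 n a b c := by
  have hn : (0 : ℝ) < n := by exact_mod_cast NeZero.pos n
  rw [Theta3, sgn3, angleFrom_exp_intCast hab, angleFrom_exp_intCast hac]
  refine if_congr ?_ rfl rfl
  rw [div_lt_div_iff_of_pos_right hn, mul_lt_mul_iff_right₀ two_pi_pos, Nat.cast_lt]

/-- (a) `ϑ_g` is a bijection from `{1, …, 2g} × {1, −1}` onto `ℤ/4gℤ`, and
(b) for letters `w_k = c_{j_k}^{η_k}` and signs `ε_k ∈ {1, −1}` with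
`w_1^{ε_1}, w_2^{ε_2}, w_3^{ε_3}` pairwise distinct (where `(c_j^η)^ε = c_j^{ηε}`),
`Θ(ε_1·T(w_1), ε_2·T(w_2), ε_3·T(w_3)) = sgn(ϑ_g(w_1^{ε_1}), ϑ_g(w_2^{ε_2}), ϑ_g(w_3^{ε_3}))`. -/
theorem statement_14 (g : ℕ) (hg : 2 ≤ g) :
    (∀ v : ZMod (4 * g), ∃! p : ℕ × ℤ,
      (1 ≤ p.1 ∧ p.1 ≤ 2 * g ∧ (p.2 = 1 ∨ p.2 = -1)) ∧ thetaMap g p.1 p.2 = v) ∧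
    (∀ j₁ j₂ j₃ : ℕ, ∀ η₁ η₂ η₃ ε₁ ε₂ ε₃ : ℤ,
      1 ≤ j₁ → j₁ ≤ 2 * g → 1 ≤ j₂ → j₂ ≤ 2 * g → 1 ≤ j₃ → j₃ ≤ 2 * g →
      (η₁ = 1 ∨ η₁ = -1) → (η₂ = 1 ∨ η₂ = -1) → (η₃ = 1 ∨ η₃ = -1) →
      (ε₁ = 1 ∨ ε₁ = -1) → (ε₂ = 1 ∨ ε₂ = -1) → (ε₃ = 1 ∨ ε₃ = -1) →
      (j₁, η₁ * ε₁) ≠ (j₂, η₂ * ε₂) → (j₁, η₁ * ε₁) ≠ (j₃, η₃ * ε₃) →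
      (j₂, η₂ * ε₂) ≠ (j₃, η₃ * ε₃) →
      Theta3 ((ε₁ : ℂ) * Tlet g j₁ η₁) ((ε₂ : ℂ) * Tlet g j₂ η₂)
          ((ε₃ : ℂ) * Tlet g j₃ η₃) =
        sgn3 (4 * g) (thetaMap g j₁ (η₁ * ε₁)) (thetaMap g j₂ (η₂ * ε₂))
          (thetaMap g j₃ (η₃ * ε₃))) := by
  have hg₀ : 0 < g := by omega
  have : NeZero (4 * g) := ⟨by omega⟩
  constructor
  · intro v
    obtain ⟨j, e, ⟨hj, hjg, he⟩, hv⟩ := exists_thetaMap_eq hg₀ v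
    refine ⟨(j, e), ⟨⟨hj, hjg, he⟩, hv⟩, ?_⟩
    rintro ⟨j', e'⟩ ⟨⟨hj', hjg', he'⟩, hv'⟩
    exact thetaMap_injective hj' hjg' hj hjg he' he (hv'.trans hv.symm)
  · intro j₁ j₂ j₃ η₁ η₂ η₃ ε₁ ε₂ ε₃ hj₁ hjg₁ hj₂ hjg₂ hj₃ hjg₃ hη₁ hη₂ hη₃ hε₁ hε₂ hε₃
      h₁₂ h₁₃ _
    rw [sign_mul_Tlet hg₀ hη₁ hε₁, sign_mul_Tlet hg₀ hη₂ hε₂, sign_mul_Tlet hg₀ hη₃ hε₃]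
    exact Theta3_exp_intCast
      (fun h => h₁₂ (thetaMap_injective hj₁ hjg₁ hj₂ hjg₂ (sign_mul_sign hη₁ hε₁)
        (sign_mul_sign hη₂ hε₂) h))
      (fun h => h₁₃ (thetaMap_injective hj₁ hjg₁ hj₃ hjg₃ (sign_mul_sign hη₁ hε₁)
        (sign_mul_sign hη₃ hε₃) h))
end
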